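/- Let λ₁,…,λₙ be distinct points in the open unit disc 𝔻 and let W₁,…,Wₙ be 2×2 complex matrices, Wₖ = [w_{ij}ᵏ], with w₁₂ᵏ w₂₁ᵏ ≠ 0 for k = 1,…,n. Then the following are equivalent: (1) there exists an analytic function F : 𝔻 → ℂ^{2×2} such that F(λₖ) = Wₖ for k = 1,…,n and μ_Diag(F(λ)) ≤ 1 for every λ ∈ 𝔻; (2) there exists an analytic map φ : 𝔻 → ℂ³ with φ(𝔻) ⊆ Ē such that φ(λₖ) = (w₁₁ᵏ, w₂₂ᵏ, det Wₖ) for k = 1,…,n. -/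

import Mathlib

/-- The closed tetrablock. -/
def closedTetra : Set (ℂ × ℂ × ℂ) :=
  {x | ∀ z ∈ Metric.ball (0:ℂ) 1, ∀ w ∈ Metric.ball (0:ℂ) 1,
        1 - x.1 * z - x.2.1 * w + x.2.2 * z * w ≠ 0}

/-- The operator norm of a 2×2 complex matrix with respect to the Euclidean norm on ℂ². -/
noncomputable def opNorm2 (A : Matrix (Fin 2) (Fin 2) ℂ) : ℝ :=
  ‖Matrix.toEuclideanCLM (𝕜 := ℂ) A‖

open scoped Classical in
/-- The structured singular value of a 2×2 matrix relative to the diagonal matrices. -/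
noncomputable def muDiag (A : Matrix (Fin 2) (Fin 2) ℂ) : ℝ :=
  if ∀ X : Matrix (Fin 2) (Fin 2) ℂ, X.IsDiag → (1 - A * X).det ≠ 0 then 0
  else
    (sInf {r : ℝ | ∃ X : Matrix (Fin 2) (Fin 2) ℂ,
        X.IsDiag ∧ (1 - A * X).det = 0 ∧ r = opNorm2 X})⁻¹

/-- The operator norm of a diagonal matrix is the sup norm of its diagonal. -/
theorem opNorm2_diagonal (v : Fin 2 → ℂ) : opNorm2 (Matrix.diagonal v) = ‖v‖ :=
  open scoped Matrix.Norms.L2Operator in Matrix.l2_opNorm_diagonal v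

theorem det_one_sub_mul_diagonal (A : Matrix (Fin 2) (Fin 2) ℂ) (v : Fin 2 → ℂ) :
    (1 - A * Matrix.diagonal v).det =
      1 - A 0 0 * v 0 - A 1 1 * v 1 + A.det * v 0 * v 1 := by
  simp [Matrix.det_fin_two]
  ring

theorem mem_closedTetra_iff (A : Matrix (Fin 2) (Fin 2) ℂ) :
    (A 0 0, A 1 1, A.det) ∈ closedTetra ↔
      ∀ v : Fin 2 → ℂ, (1 - A * Matrix.diagonal v).det = 0 → 1 ≤ ‖v‖ := by
  simp only [det_one_sub_mul_diagonal]
  constructor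
  · intro h v hv
    by_contra! hlt
    rw [pi_norm_lt_iff one_pos] at hlt
    exact h (v 0) (by simpa using hlt 0) (v 1) (by simpa using hlt 1) hv
  · intro h z hz w hw h0
    refine (h ![z, w] (by simpa using h0)).not_gt ?_
    rw [pi_norm_lt_iff one_pos, Fin.forall_fin_two]
    exact ⟨by simpa using hz, by simpa using hw⟩

/-- Diagonal matrices `X` with `1 - A * X` singular are bounded away from zero. -/
theorem exists_pos_le_norm_of_det_eq_zero (A : Matrix (Fin 2) (Fin 2) ℂ) :
    ∃ c > 0, ∀ v : Fin 2 → ℂ, (1 - A * Matrix.diagonal v).det = 0 → c ≤ ‖v‖ := by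
  have hcont : Continuous fun v : Fin 2 → ℂ => (1 - A * Matrix.diagonal v).det := by
    simp only [det_one_sub_mul_diagonal]
    fun_prop
  have hne : ∀ᶠ v in nhds (0 : Fin 2 → ℂ), (1 - A * Matrix.diagonal v).det ≠ 0 :=
    hcont.continuousAt.eventually_ne (by simp)
  obtain ⟨c, hc, hball⟩ := Metric.eventually_nhds_iff.1 hne
  refine ⟨c, hc, fun v hv => ?_⟩
  by_contra! hlt
  exact hball (by simpa using hlt) hv

theorem muDiag_le_one_iff (A : Matrix (Fin 2) (Fin 2) ℂ) :
    muDiag A ≤ 1 ↔ (A 0 0, A 1 1, A.det) ∈ closedTetra := by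
  have hset : {r : ℝ | ∃ X : Matrix (Fin 2) (Fin 2) ℂ,
      X.IsDiag ∧ (1 - A * X).det = 0 ∧ r = opNorm2 X} =
      norm '' {v : Fin 2 → ℂ | (1 - A * Matrix.diagonal v).det = 0} := by
    ext r
    constructor
    · rintro ⟨X, hX, hdet, rfl⟩
      rw [← hX.diagonal_diag] at hdet ⊢
      exact ⟨X.diag, hdet, (opNorm2_diagonal _).symm⟩
    · rintro ⟨v, hv, rfl⟩
      exact ⟨_, Matrix.isDiag_diagonal v, hv, (opNorm2_diagonal v).symm⟩
  rw [mem_closedTetra_iff, muDiag, hset]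
  split_ifs with h
  · exact iff_of_true zero_le_one
      fun v hv => absurd hv (h _ (Matrix.isDiag_diagonal v))
  · push Not at h
    obtain ⟨X, hX, hdet⟩ := h
    have hnonempty : (norm '' {v : Fin 2 → ℂ | (1 - A * Matrix.diagonal v).det = 0}).Nonempty :=
      ⟨_, X.diag, by simpa [hX.diagonal_diag] using hdet, rfl⟩
    obtain ⟨c, hc, hle⟩ := exists_pos_le_norm_of_det_eq_zero A
    have hbdd : c ∈ lowerBounds
        (norm '' {v : Fin 2 → ℂ | (1 - A * Matrix.diagonal v).det = 0}) := by
      rintro _ ⟨v, hv, rfl⟩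
      exact hle v hv
    rw [inv_le_one₀ (hc.trans_le (le_csInf hnonempty hbdd)), le_csInf_iff ⟨c, hbdd⟩ hnonempty]
    simp

/-- Nonzero values at distinct points are interpolated by a zero-free entire function. -/
theorem exists_differentiable_ne_zero_interpolating {ι : Type*} [Fintype ι] {x : ι → ℂ}
    (hx : Function.Injective x) {y : ι → ℂ} (hy : ∀ k, y k ≠ 0) :
    ∃ g : ℂ → ℂ, Differentiable ℂ g ∧ (∀ z, g z ≠ 0) ∧ ∀ k, g (x k) = y k := by
  classical
  refine ⟨fun z => Complex.exp
    ((Lagrange.interpolate Finset.univ x fun k => Complex.log (y k)).eval z),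
    (Polynomial.differentiable _).cexp, fun z => Complex.exp_ne_zero _, fun k => ?_⟩
  beta_reduce
  rw [Lagrange.eval_interpolate_at_node _ hx.injOn (Finset.mem_univ k), Complex.exp_log (hy k)]

theorem stmt_15 (n : ℕ) (lam : Fin n → ℂ) (hlam : ∀ k, lam k ∈ Metric.ball (0:ℂ) 1)
    (hinj : Function.Injective lam) (W : Fin n → Matrix (Fin 2) (Fin 2) ℂ)
    (hW : ∀ k, W k 0 1 * W k 1 0 ≠ 0) :
    (∃ F : ℂ → Matrix (Fin 2) (Fin 2) ℂ,
        (∀ i j, DifferentiableOn ℂ (fun z => F z i j) (Metric.ball (0:ℂ) 1)) ∧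
        (∀ k, F (lam k) = W k) ∧
        ∀ z ∈ Metric.ball (0:ℂ) 1, muDiag (F z) ≤ 1) ↔
    (∃ φ : ℂ → ℂ × ℂ × ℂ,
        DifferentiableOn ℂ φ (Metric.ball (0:ℂ) 1) ∧
        (∀ z ∈ Metric.ball (0:ℂ) 1, φ z ∈ closedTetra) ∧
        ∀ k, φ (lam k) = (W k 0 0, W k 1 1, (W k).det)) := by
  constructor
  · rintro ⟨F, hF, hFW, hmu⟩
    refine ⟨fun z => (F z 0 0, F z 1 1, (F z).det), ?_,
      fun z hz => (muDiag_le_one_iff _).1 (hmu z hz), fun k => by simp only [hFW]⟩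
    simp only [Matrix.det_fin_two]
    exact (hF 0 0).prodMk ((hF 1 1).prodMk
      (((hF 0 0).mul (hF 1 1)).sub ((hF 0 1).mul (hF 1 0))))
  · rintro ⟨φ, hφ, hmem, hφW⟩
    obtain ⟨g, hg, hg0, hgW⟩ := exists_differentiable_ne_zero_interpolating hinj
      fun k => left_ne_zero_of_mul (hW k)
    have h1 := hφ.fst
    have h2 := hφ.snd.fst
    have h3 := hφ.snd.snd
    have hdet : ∀ z, (!![(φ z).1, g z; ((φ z).1 * (φ z).2.1 - (φ z).2.2) / g z,
        (φ z).2.1]).det = (φ z).2.2 := fun z => by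
      rw [Matrix.det_fin_two_of, mul_div_cancel₀ _ (hg0 z), sub_sub_cancel]
    refine ⟨fun z => !![(φ z).1, g z; ((φ z).1 * (φ z).2.1 - (φ z).2.2) / g z, (φ z).2.1],
      ?_, fun k => ?_, fun z hz => ?_⟩
    · simp only [Fin.forall_fin_two]
      exact ⟨⟨h1, hg.differentiableOn⟩,
        ((h1.mul h2).sub h3).div hg.differentiableOn fun z _ => hg0 z, h2⟩
    · have h01 : W k 0 1 ≠ 0 := left_ne_zero_of_mul (hW k)
      ext i j
      fin_cases i <;> fin_cases j <;> simp [hφW, hgW, Matrix.det_fin_two, h01]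
    · rw [muDiag_le_one_iff, hdet]
      exact hmem z hz
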